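/- arXiv:1009.1125 — 6 statements merged into one kernel-verified Lean document; each statement's English description precedes it below -/
import Mathlib

section
/- Let r, s, t be natural numbers with s < r ≤ 2s and t ≤ r−s−1. Then in ZMod 2 one has C(s−r+t, s−t) = C(r−1−2t, r−s−1−t); that is, the mod 2 binomial coefficient with negative top entry s−r+t and bottom entry s−t equals the ordinary binomial coefficient (r−1−2t choose r−s−1−t) reduced mod 2. -/
/-- The mod 2 binomial coefficient `C(a,b) ∈ ZMod 2` for integers `a`, `b`:
the coefficient of `x^b` in `(1+x)^a`.  It is `0` for `b < 0`, and for `b ≥ 0` it is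
the mod 2 reduction of the generalized binomial coefficient `a(a-1)⋯(a-b+1)/b!`. -/
noncomputable def modTwoBinom (a b : ℤ) : ZMod 2 :=
  if b < 0 then 0 else ((Ring.choose a b.toNat : ℤ) : ZMod 2)

/-- The mod 2 reduction of `C(-m, n)` is that of `C(m + n - 1, n)`; here `m = k + 1`. -/
theorem modTwoBinom_neg_succ (k n : ℕ) :
    modTwoBinom (-((k : ℤ) + 1)) n = ((k + n).choose n : ZMod 2) := by
  have h : (k : ℤ) + 1 + n - 1 = ((k + n : ℕ) : ℤ) := by push_cast; ring
  rw [modTwoBinom, if_neg (by lia), Int.toNat_natCast, Ring.choose_neg, h, Ring.choose_natCast]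
  rcases Int.units_eq_one_or (Int.negOnePow n) with hu | hu <;> simp [hu, Units.smul_def]

/-- For natural numbers `r, s, t` with `s < r ≤ 2s` and `t ≤ r - s - 1`, the mod 2
binomial coefficient `C(s - r + t, s - t)` equals the ordinary binomial coefficient
`(r - 1 - 2t).choose (r - s - 1 - t)` reduced mod 2. -/
theorem modTwoBinom_negTop_eq (r s t : ℕ) (h1 : s < r) (h2 : r ≤ 2 * s)
    (h3 : t ≤ r - s - 1) :
    modTwoBinom ((s : ℤ) - r + t) ((s : ℤ) - t) =
      ((r - 1 - 2 * t).choose (r - s - 1 - t) : ZMod 2) := by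
  obtain ⟨k, rfl⟩ : ∃ k, r = s + t + k + 1 := ⟨r - s - t - 1, by lia⟩
  obtain ⟨n, rfl⟩ : ∃ n, s = t + n := ⟨s - t, by lia⟩
  have ha : ((t + n : ℕ) : ℤ) - ((t + n + t + k + 1 : ℕ) : ℤ) + t = -((k : ℤ) + 1) := by
    push_cast; ring
  have hb : ((t + n : ℕ) : ℤ) - t = n := by push_cast; ring
  have hc : t + n + t + k + 1 - 1 - 2 * t = k + n := by lia
  have hd : t + n + t + k + 1 - (t + n) - 1 - t = k := by lia
  rw [ha, hb, hc, hd, modTwoBinom_neg_succ, Nat.choose_symm_add]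
end

section
/- Let r, s be natural numbers with r > 2s and let t be any integer. If the mod 2 binomial coefficient C(t+s−r, 2t−r) is nonzero, then r ≤ 2t and t ≤ r−s−1; consequently s < t and the pair (r+s−t, t) is admissible, i.e. r+s−t ≤ 2t. In particular, the Adem relation Q^r Q^s = ∑_t C(t+s−r, 2t−r) Q^{r+s−t} Q^t rewrites an inadmissible pair as a sum of admissible pairs of the same total degree r+s. -/
/-- `C(a,b)` vanishes when `b` is negative. -/
theorem modTwoBinom_of_neg (a : ℤ) {b : ℤ} (hb : b < 0) : modTwoBinom a b = 0 :=
  if_pos hb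

/-- `C(a,b)` vanishes when `0 ≤ a < b`. -/
theorem modTwoBinom_of_lt {a b : ℤ} (ha : 0 ≤ a) (hab : a < b) : modTwoBinom a b = 0 := by
  lift a to ℕ using ha
  lift b to ℕ using by omega
  have hlt : a < b := by exact_mod_cast hab
  simp [modTwoBinom, Ring.choose_natCast, Nat.choose_eq_zero_of_lt hlt]

/-- Let `r, s` be natural numbers with `r > 2s` and let `t` be any integer.  If the
mod 2 binomial coefficient `C(t + s - r, 2t - r)` is nonzero, then `r ≤ 2t` and
`t ≤ r - s - 1`; consequently `s < t` and the pair `(r + s - t, t)` is admissible,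
i.e. `r + s - t ≤ 2t`.  (Thus the Adem relation rewrites an inadmissible pair as a
sum of admissible pairs of the same total degree.) -/
theorem adem_admissible (r s : ℕ) (h : 2 * s < r) (t : ℤ)
    (hC : modTwoBinom (t + s - r) (2 * t - r) ≠ 0) :
    (r : ℤ) ≤ 2 * t ∧ t ≤ (r : ℤ) - s - 1 ∧ (s : ℤ) < t ∧ (r : ℤ) + s - t ≤ 2 * t := by
  have hrt : (r : ℤ) ≤ 2 * t := by
    by_contra hlt
    exact hC (modTwoBinom_of_neg _ (by omega))
  have hts : t ≤ (r : ℤ) - s - 1 := by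
    by_contra hlt
    exact hC (modTwoBinom_of_lt (by omega) (by omega))
  exact ⟨hrt, hts, by omega, by omega⟩
end

section
/- Let n ≥ 1 and let (j_1, …, j_k) be any finite sequence of natural numbers. Then the image of the word q_{j_1}⋯q_{j_k} in R̄_n is a ZMod 2-linear combination of images of words q_{i_1}⋯q_{i_k} of the same length k and the same degree i_1+⋯+i_k = j_1+⋯+j_k, where each sequence (i_1, …, i_k) is completely unadmissible with i_k ≥ n. In particular, R̄_n is spanned over ZMod 2 by the unit 1 together with the images of the CU monomials of excess at least n. -/
/-- The word `q_{j_1} ⋯ q_{j_k}` in the free associative unital `ZMod 2`-algebra on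
generators `q_j` indexed by natural numbers `j`. -/
noncomputable def word (J : List ℕ) : FreeAlgebra (ZMod 2) ℕ :=
  (J.map (FreeAlgebra.ι (ZMod 2))).prod

/-- The relations defining `R̄_n`: (1) the excess relations, killing every word
`q_{j_1}⋯q_{j_k}` (`k ≥ 1`) with `j_1 < j_2 + ⋯ + j_k + n`; and (2) the relations
`q_r·q_s = ∑_{ℓ=0}^{r-s-1} ((2s-r+1+2ℓ) choose ℓ mod 2)·q_{2s+1+ℓ}·q_{r-s-1-ℓ}`
for `s < r ≤ 2s` (equivalently, in characteristic 2, the two-sided ideal generated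
by the sums `q_r·q_s + ∑_ℓ ⋯`). -/
inductive BarRel (n : ℕ) : FreeAlgebra (ZMod 2) ℕ → FreeAlgebra (ZMod 2) ℕ → Prop
  | excess (j : ℕ) (J : List ℕ) (h : j < J.sum + n) : BarRel n (word (j :: J)) 0
  | adem (r s : ℕ) (h1 : s < r) (h2 : r ≤ 2 * s) :
      BarRel n (FreeAlgebra.ι (ZMod 2) r * FreeAlgebra.ι (ZMod 2) s)
        (∑ ℓ ∈ Finset.range (r - s),
          ((2 * s - r + 1 + 2 * ℓ).choose ℓ : ZMod 2) •
            (FreeAlgebra.ι (ZMod 2) (2 * s + 1 + ℓ) * FreeAlgebra.ι (ZMod 2) (r - s - 1 - ℓ)))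

/-- The algebra `R̄_n`: the quotient of the free associative unital `ZMod 2`-algebra on
the generators `q_j` by the two-sided ideal generated by the relations `BarRel n`. -/
noncomputable def BarR (n : ℕ) := RingQuot (BarRel n)

noncomputable instance (n : ℕ) : Ring (BarR n) :=
  inferInstanceAs (Ring (RingQuot (BarRel n)))

noncomputable instance (n : ℕ) : Algebra (ZMod 2) (BarR n) :=
  inferInstanceAs (Algebra (ZMod 2) (RingQuot (BarRel n)))

/-- The quotient map `FreeAlgebra (ZMod 2) ℕ → R̄_n`. -/
noncomputable def barMk (n : ℕ) : FreeAlgebra (ZMod 2) ℕ →ₐ[ZMod 2] BarR n :=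
  RingQuot.mkAlgHom (ZMod 2) (BarRel n)

/-- The weighted sum of a list in which the entry at position `s` of a list
of length `k` (counting from `0`) is counted with weight `k - s`. -/
def positionWeight : List ℕ → ℕ
  | [] => 0
  | a :: L => a * (L.length + 1) + positionWeight L

theorem positionWeight_le (L : List ℕ) : positionWeight L ≤ L.length * L.sum := by
  induction L with
  | nil => simp [positionWeight]
  | cons a L ih =>
    simp only [positionWeight, List.length_cons, List.sum_cons]
    nlinarith [Nat.zero_le L.sum]

theorem positionWeight_append (A B : List ℕ) :
    positionWeight (A ++ B) = positionWeight A + A.sum * B.length + positionWeight B := by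
  induction A with
  | nil => simp [positionWeight]
  | cons a A ih =>
    simp only [List.cons_append, positionWeight, ih, List.length_append, List.sum_cons]
    ring

theorem exists_append_of_not_isChain {α : Type*} {R : α → α → Prop} {L : List α}
    (h : ¬ L.IsChain R) : ∃ A a b B, L = A ++ a :: b :: B ∧ ¬ R a b := by
  induction L with
  | nil => exact absurd List.IsChain.nil h
  | cons a L ih =>
    cases L with
    | nil => exact absurd (List.IsChain.singleton a) h
    | cons b L =>
      by_cases hab : R a b
      · have hL : ¬ (b :: L).IsChain R := fun hL => h (List.isChain_cons_cons.2 ⟨hab, hL⟩)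
        obtain ⟨A, c, d, B, hB, hcd⟩ := ih hL
        exact ⟨a :: A, c, d, B, by rw [hB, List.cons_append], hcd⟩
      · exact ⟨[], a, b, L, rfl, hab⟩

theorem word_append (A B : List ℕ) : word (A ++ B) = word A * word B := by
  simp [word]

theorem word_cons_cons (a b : ℕ) (B : List ℕ) :
    word (a :: b :: B) = FreeAlgebra.ι (ZMod 2) a * FreeAlgebra.ι (ZMod 2) b * word B := by
  simp [word, mul_assoc]

theorem barMk_eq_of_barRel {n : ℕ} {x y : FreeAlgebra (ZMod 2) ℕ} (h : BarRel n x y) :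
    barMk n x = barMk n y :=
  RingQuot.mkAlgHom_rel (ZMod 2) h

/-- A word vanishes in `R̄_n` as soon as one of its suffixes violates the excess condition. -/
theorem barMk_word_eq_zero {n : ℕ} (A : List ℕ) {a : ℕ} {B : List ℕ} (h : a < B.sum + n) :
    barMk n (word (A ++ a :: B)) = 0 := by
  rw [word_append, map_mul, barMk_eq_of_barRel (BarRel.excess a B h), map_zero, mul_zero]

/-- The Adem-type relation applied to two adjacent letters inside a word. -/
theorem barMk_word_adem {n : ℕ} (A B : List ℕ) {r s : ℕ} (h1 : s < r) (h2 : r ≤ 2 * s) :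
    barMk n (word (A ++ r :: s :: B)) = ∑ l ∈ Finset.range (r - s),
      ((2 * s - r + 1 + 2 * l).choose l : ZMod 2) •
        barMk n (word (A ++ (2 * s + 1 + l) :: (r - s - 1 - l) :: B)) := by
  simp only [word_append, word_cons_cons, map_mul (barMk n) (word A)]
  rw [map_mul, barMk_eq_of_barRel (BarRel.adem r s h1 h2), map_sum, Finset.sum_mul,
    Finset.mul_sum]
  refine Finset.sum_congr rfl fun l _ => ?_
  rw [map_smul, smul_mul_assoc, mul_smul_comm, map_mul (barMk n) _ (word B)]

/-- For `n ≥ 1` and any finite sequence `(j_1, …, j_k)` of natural numbers, the image of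
`q_{j_1}⋯q_{j_k}` in `R̄_n` is a `ZMod 2`-linear combination of images of words
`q_{i_1}⋯q_{i_k}` of the same length and the same degree, where each `(i_1, …, i_k)` is
completely unadmissible (`i_s ≥ 2·i_{s+1} + 1` for consecutive entries) with last entry
(excess) at least `n`. -/
theorem barR_span_CU (n : ℕ) (hn : 1 ≤ n) (J : List ℕ) :
    barMk n (word J) ∈
      Submodule.span (ZMod 2)
        {x : BarR n | ∃ I : List ℕ, I.length = J.length ∧ I.sum = J.sum ∧
          List.Chain' (fun a b => 2 * b + 1 ≤ a) I ∧ (∀ m ∈ I.getLast?, n ≤ m) ∧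
          x = barMk n (word I)} := by
  induction hm : J.length * J.sum - positionWeight J using Nat.strong_induction_on
    generalizing J with
  | _ m ih =>
  by_cases hexc : ∃ A a B, J = A ++ a :: B ∧ a < B.sum + n
  · obtain ⟨A, a, B, rfl, h⟩ := hexc
    rw [barMk_word_eq_zero A h]
    exact zero_mem _
  push Not at hexc
  by_cases hJ : J.IsChain (fun a b => 2 * b + 1 ≤ a)
  · refine Submodule.subset_span ⟨J, rfl, rfl, hJ, fun c hc => ?_, rfl⟩
    obtain ⟨A, rfl⟩ := List.getLast?_eq_some_iff.1 hc
    simpa using hexc A c [] rfl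
  obtain ⟨A, r, s, B, rfl, hrs⟩ := exists_append_of_not_isChain hJ
  have h1 : s < r := by
    have := hexc A r (s :: B) rfl
    rw [List.sum_cons] at this
    omega
  have h2 : r ≤ 2 * s := by omega
  rw [barMk_word_adem A B h1 h2]
  refine Submodule.sum_mem _ fun l hl => Submodule.smul_mem _ _ ?_
  rw [Finset.mem_range] at hl
  set K := A ++ (2 * s + 1 + l) :: (r - s - 1 - l) :: B with hK
  have hlen : K.length = (A ++ r :: s :: B).length := by simp [hK]
  have hsum : K.sum = (A ++ r :: s :: B).sum := by
    simp only [hK, List.sum_append, List.sum_cons]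
    omega
  have hlt : positionWeight (A ++ r :: s :: B) < positionWeight K := by
    simp only [hK, positionWeight_append, positionWeight, List.length_cons]
    obtain ⟨d, hd⟩ : ∃ d, 2 * s + 1 + l = r + 1 + d := ⟨2 * s + l - r, by omega⟩
    obtain ⟨t, ht⟩ : ∃ t, s = t + 1 + d := ⟨r - s - 1 - l, by omega⟩
    have ht' : r - s - 1 - l = t := by omega
    rw [hd, ht', ht]
    nlinarith
  have hle := positionWeight_le K
  rw [← hlen, ← hsum] at hm ⊢
  exact ih _ (by omega) K rfl
end

section
/- Let n ≥ 1 and j be a natural number. The image of the generator q_j in R̄_n is zero if and only if j < n. -/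
open DualNumber in
/-- The algebra map to the dual numbers sending `q_j` to `ε` and every other generator to `0`. -/
noncomputable def toDual (j : ℕ) : FreeAlgebra (ZMod 2) ℕ →ₐ[ZMod 2] DualNumber (ZMod 2) :=
  FreeAlgebra.lift (ZMod 2) fun i => if i = j then ε else 0

open DualNumber in
theorem toDual_ι (j i : ℕ) :
    toDual j (FreeAlgebra.ι (ZMod 2) i) = if i = j then ε else 0 := by
  simp [toDual]

theorem toDual_ι_mul_ι (j a b : ℕ) :
    toDual j (FreeAlgebra.ι (ZMod 2) a) * toDual j (FreeAlgebra.ι (ZMod 2) b) = 0 := by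
  rw [toDual_ι, toDual_ι]
  split_ifs <;> simp

theorem toDual_eq_of_barRel {n j : ℕ} (hj : n ≤ j) ⦃x y : FreeAlgebra (ZMod 2) ℕ⦄
    (h : BarRel n x y) : toDual j x = toDual j y := by
  cases h with
  | excess i J h =>
    cases J with
    | nil =>
      have hij : i ≠ j := by simp at h; omega
      simp [word, toDual_ι, hij]
    | cons k J => simp [word, ← mul_assoc, toDual_ι_mul_ι]
  | adem r s h1 h2 => simp [toDual_ι_mul_ι]

/-- For `n ≥ 1` and a natural number `j`, the image of the generator `q_j` in `R̄_n`
is zero if and only if `j < n`. -/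
theorem barR_gen_eq_zero_iff (n : ℕ) (hn : 1 ≤ n) (j : ℕ) :
    barMk n (FreeAlgebra.ι (ZMod 2) j) = 0 ↔ j < n := by
  constructor
  · intro h
    by_contra! hj
    have h0 : RingQuot.liftAlgHom (ZMod 2) ⟨toDual j, toDual_eq_of_barRel hj⟩
        (RingQuot.mkAlgHom (ZMod 2) (BarRel n) (FreeAlgebra.ι (ZMod 2) j)) = 0 :=
      (congrArg _ h).trans (map_zero _)
    rw [RingQuot.liftAlgHom_mkAlgHom_apply, toDual_ι, if_pos rfl] at h0
    simpa using congrArg TrivSqZeroExt.snd h0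
  · intro h
    have h0 := RingQuot.mkAlgHom_rel (ZMod 2) (BarRel.excess (n := n) j [] (by simpa using h))
    rw [map_zero] at h0
    simp only [word, List.map_cons, List.map_nil, List.prod_singleton] at h0
    exact h0
end

section
/- Let n ≥ 0 and let (j_1, …, j_k) be a finite sequence of natural numbers with each j_m ≥ n. Then the image of the word q_{j_1}⋯q_{j_k} in the mod 2 Dyer–Lashof algebra R_n is a ZMod 2-linear combination of images of words q_{i_1}⋯q_{i_k} of the same length k and the same degree i_1+⋯+i_k = j_1+⋯+j_k, where each sequence (i_1, …, i_k) is admissible of excess at least n, i.e. i_m ≤ 2·i_{m+1} for all 1 ≤ m ≤ k−1 and i_1 ≥ i_2+⋯+i_k+n. -/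
/-- The generators of the mod 2 Dyer–Lashof algebra `R_n`: natural numbers `j ≥ n`. -/
abbrev DLGen (n : ℕ) := {j : ℕ // n ≤ j}

/-- The word `q_{j_1} ⋯ q_{j_k}` in the free associative unital `ZMod 2`-algebra on
the generators `q_j`, `j ≥ n`. -/
noncomputable def dlWord (n : ℕ) (J : List (DLGen n)) : FreeAlgebra (ZMod 2) (DLGen n) :=
  (J.map (FreeAlgebra.ι (ZMod 2))).prod

/-- The right-hand side of the Adem relation in the Dyer–Lashof algebra:
`∑_t ((t-s-1) choose (2t-r) mod 2)·q_{r+s-t}·q_t`, the sum over natural numbers `t`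
with `r ≤ 2t` and `t ≤ r-s-1`. -/
noncomputable def dlAdemSum (n r s : ℕ) (hs : n ≤ s) (hrs : 2 * s < r) :
    FreeAlgebra (ZMod 2) (DLGen n) :=
  ∑ t ∈ ((Finset.range (r - s)).filter fun t => r ≤ 2 * t).attach,
    ((t.1 - s - 1).choose (2 * t.1 - r) : ZMod 2) •
      (FreeAlgebra.ι (ZMod 2)
          (⟨r + s - t.1, by
            have ht := t.2
            simp only [Finset.mem_filter, Finset.mem_range] at ht
            omega⟩ : DLGen n) *
        FreeAlgebra.ι (ZMod 2)
          (⟨t.1, by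
            have ht := t.2
            simp only [Finset.mem_filter, Finset.mem_range] at ht
            omega⟩ : DLGen n))

/-- The relations defining the mod 2 Dyer–Lashof algebra `R_n`: (excess relations)
every word `q_{j_1}⋯q_{j_k}` with `j_1 < j_2 + ⋯ + j_k + n` is killed; and (Adem
relations) for `r > 2s` with `s ≥ n`, `q_r·q_s = ∑_t ((t-s-1) choose (2t-r) mod 2)·
q_{r+s-t}·q_t`, the sum over `t` with `r ≤ 2t` and `t ≤ r-s-1` (equivalently, in
characteristic 2, the two-sided ideal generated by `q_r·q_s + ∑_t ⋯`). -/
inductive DLRel (n : ℕ) :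
    FreeAlgebra (ZMod 2) (DLGen n) → FreeAlgebra (ZMod 2) (DLGen n) → Prop
  | excess (j : DLGen n) (J : List (DLGen n)) (h : j.1 < (J.map Subtype.val).sum + n) :
      DLRel n (dlWord n (j :: J)) 0
  | adem (r s : ℕ) (hs : n ≤ s) (hrs : 2 * s < r) :
      DLRel n
        (FreeAlgebra.ι (ZMod 2) (⟨r, by omega⟩ : DLGen n) *
          FreeAlgebra.ι (ZMod 2) (⟨s, hs⟩ : DLGen n))
        (dlAdemSum n r s hs hrs)

/-- The mod 2 Dyer–Lashof algebra `R_n`: the quotient of the free associative unital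
`ZMod 2`-algebra on the generators `q_j` (`j ≥ n`) by the two-sided ideal generated by
the excess and Adem relations. -/
noncomputable def DL (n : ℕ) := RingQuot (DLRel n)

noncomputable instance (n : ℕ) : Ring (DL n) :=
  inferInstanceAs (Ring (RingQuot (DLRel n)))

noncomputable instance (n : ℕ) : Algebra (ZMod 2) (DL n) :=
  inferInstanceAs (Algebra (ZMod 2) (RingQuot (DLRel n)))

/-- The quotient map onto the Dyer–Lashof algebra `R_n`. -/
noncomputable def dlMk (n : ℕ) : FreeAlgebra (ZMod 2) (DLGen n) →ₐ[ZMod 2] DL n :=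
  RingQuot.mkAlgHom (ZMod 2) (DLRel n)

/-- The moment of a word: each index is weighted by the number of letters to its right. -/
def dlMoment (n : ℕ) : List (DLGen n) → ℕ
  | [] => 0
  | a :: l => a.1 * l.length + dlMoment n l

theorem dlMoment_append_lt {n : ℕ} {r s r' s' : DLGen n} (hr : r'.1 < r.1)
    (hsum : r'.1 + s'.1 = r.1 + s.1) (A B : List (DLGen n)) :
    dlMoment n (A ++ r' :: s' :: B) < dlMoment n (A ++ r :: s :: B) := by
  induction A with
  | nil =>
    simp only [List.nil_append, dlMoment, List.length_cons]
    have h : r'.1 * B.length + s'.1 * B.length = r.1 * B.length + s.1 * B.length := by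
      rw [← add_mul, ← add_mul, hsum]
    linarith
  | cons a A ih =>
    simpa [dlMoment] using ih

theorem dlWord_append_cons_cons (n : ℕ) (A B : List (DLGen n)) (r s : DLGen n) :
    dlWord n (A ++ r :: s :: B) =
      dlWord n A * (FreeAlgebra.ι (ZMod 2) r * FreeAlgebra.ι (ZMod 2) s) * dlWord n B := by
  simp [dlWord, mul_assoc]

theorem dlMk_eq_of_rel {n : ℕ} {x y : FreeAlgebra (ZMod 2) (DLGen n)} (h : DLRel n x y) :
    dlMk n x = dlMk n y :=
  RingQuot.mkAlgHom_rel (ZMod 2) h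

/-- A submodule of `R_n` contains the word `A q_r q_s B` with `r > 2s` as soon as it contains
every word `A q_{r'} q_{s'} B` with `r' < r` and `r' + s' = r + s`. -/
theorem dlMk_append_cons_cons_mem {n : ℕ} {A B : List (DLGen n)} {r s : DLGen n}
    (hrs : 2 * s.1 < r.1) (M : Submodule (ZMod 2) (DL n))
    (hM : ∀ r' s' : DLGen n, r'.1 < r.1 → r'.1 + s'.1 = r.1 + s.1 →
      dlMk n (dlWord n (A ++ r' :: s' :: B)) ∈ M) :
    dlMk n (dlWord n (A ++ r :: s :: B)) ∈ M := by
  rw [dlWord_append_cons_cons, map_mul, map_mul,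
    dlMk_eq_of_rel (DLRel.adem r.1 s.1 s.2 hrs), dlAdemSum, map_sum, Finset.mul_sum,
    Finset.sum_mul]
  refine Submodule.sum_mem _ fun t _ => ?_
  rw [map_smul, mul_smul_comm, smul_mul_assoc, ← map_mul, ← map_mul, ← dlWord_append_cons_cons]
  have ht := t.2
  simp only [Finset.mem_filter, Finset.mem_range] at ht
  exact M.smul_mem _ (hM _ _ (by dsimp only; omega) (by dsimp only; omega))

/-- For `n ≥ 0` and any finite sequence `(j_1, …, j_k)` of natural numbers with each
`j_m ≥ n`, the image of `q_{j_1}⋯q_{j_k}` in `R_n` is a `ZMod 2`-linear combination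
of images of words `q_{i_1}⋯q_{i_k}` of the same length and the same degree, where
each `(i_1, …, i_k)` is admissible (`i_m ≤ 2·i_{m+1}` for consecutive entries) of
excess at least `n` (`i_1 ≥ i_2 + ⋯ + i_k + n`). -/
theorem dl_span_admissible (n : ℕ) (J : List (DLGen n)) :
    dlMk n (dlWord n J) ∈
      Submodule.span (ZMod 2)
        {x : DL n | ∃ I : List (DLGen n), I.length = J.length ∧
          (I.map Subtype.val).sum = (J.map Subtype.val).sum ∧
          List.Chain' (fun a b : DLGen n => a.1 ≤ 2 * b.1) I ∧
          (∀ i ∈ I.head?, (I.tail.map Subtype.val).sum + n ≤ i.1) ∧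
          x = dlMk n (dlWord n I)} := by
  induction hm : dlMoment n J using Nat.strong_induction_on generalizing J with
  | _ m ih =>
  subst hm
  by_cases hchain : List.IsChain (fun a b : DLGen n => a.1 ≤ 2 * b.1) J
  · by_cases hex : ∀ i ∈ J.head?, (J.tail.map Subtype.val).sum + n ≤ i.1
    · exact Submodule.subset_span ⟨J, rfl, rfl, hchain, hex, rfl⟩
    · cases J with
      | nil => simp at hex
      | cons j J =>
        have hlt : j.1 < (J.map Subtype.val).sum + n := by simpa using hex
        rw [dlMk_eq_of_rel (DLRel.excess j J hlt), map_zero]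
        exact Submodule.zero_mem _
  · rw [List.isChain_iff_forall_rel_of_append_cons_cons] at hchain
    push Not at hchain
    obtain ⟨r, s, A, B, rfl, hrs⟩ := hchain
    refine dlMk_append_cons_cons_mem hrs _ fun r' s' hr hsum => ?_
    have h := ih _ (dlMoment_append_lt hr hsum A B) _ rfl
    have hdeg : ((A ++ r' :: s' :: B).map Subtype.val).sum =
        ((A ++ r :: s :: B).map Subtype.val).sum := by
      simp only [List.map_append, List.map_cons, List.sum_append, List.sum_cons]
      omega
    have hlen : (A ++ r' :: s' :: B).length = (A ++ r :: s :: B).length := by simp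
    rwa [hdeg, hlen] at h
end

section
/- Let n ≥ 0. The images in the mod 2 Dyer–Lashof algebra R_n of the words q_{j_1}⋯q_{j_k}, as (j_1, …, j_k) ranges over all admissible sequences of natural numbers ≥ n of all lengths k ≥ 0 with excess j_1 − (j_2+⋯+j_k) ≥ n (the empty sequence contributing the unit 1), form a basis of R_n as a ZMod 2-vector space. -/
/-- The index set for the admissible basis of `R_n`: admissible sequences of natural
numbers `≥ n` (of all lengths, the empty sequence included) of excess at least `n`. -/
def AdmSeq (n : ℕ) : Type :=
  {I : List (DLGen n) // List.Chain' (fun a b : DLGen n => a.1 ≤ 2 * b.1) I ∧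
    ∀ i ∈ I.head?, (I.tail.map Subtype.val).sum + n ≤ i.1}

namespace DyerLashof

theorem coeff_mul_inv_pow_eq_choose {R : Type*} [CommRing R] [CharP R 2]
    (u : PowerSeries R) (hu : u * (1 + PowerSeries.X) = 1) (p b : ℕ) :
    PowerSeries.coeff b ((1 + PowerSeries.X + PowerSeries.X ^ 2) ^ p * u ^ (b + 1)) =
      (p.choose b : R) := by
  induction p generalizing b with
  | zero =>
    have h4 : u ^ (b + 1) = (PowerSeries.invOneSubPow R (b + 1)).val := by
      have h1 : (1 - PowerSeries.X : PowerSeries R) = 1 + PowerSeries.X := by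
        ext k
        simp [CharTwo.sub_eq_add]
      have h3 := (PowerSeries.invOneSubPow R (b + 1)).inv_val
      rw [PowerSeries.invOneSubPow_inv_eq_one_sub_pow, h1] at h3
      rw [← mul_one (u ^ (b + 1)), ← h3, ← mul_assoc, ← mul_pow, hu, one_pow, one_mul]
    rw [pow_zero, one_mul, h4, PowerSeries.invOneSubPow_val_succ_eq_mk_add_choose]
    cases b with
    | zero => simp
    | succ b =>
      rw [PowerSeries.coeff_mk, ← two_mul]
      have h2 : ((2 * (b + 1)).choose (b + 1) : R) = 0 :=
        (CharP.cast_eq_zero_iff R 2 _).2 (Nat.two_dvd_centralBinom_succ b)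
      simp [h2]
  | succ p ih =>
    have hsplit (k : ℕ) : (1 + PowerSeries.X + PowerSeries.X ^ 2) ^ (p + 1) * u ^ (k + 1) =
        (1 + PowerSeries.X + PowerSeries.X ^ 2) ^ p * u ^ (k + 1) +
          PowerSeries.X * ((1 + PowerSeries.X + PowerSeries.X ^ 2) ^ p * u ^ k) := by
      linear_combination (PowerSeries.X * (1 + PowerSeries.X + PowerSeries.X ^ 2) ^ p * u ^ k) * hu
    rw [hsplit, map_add, ih]
    cases b with
    | zero => simp
    | succ b =>
      rw [PowerSeries.coeff_succ_X_mul, ih, Nat.choose_succ_succ]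
      push_cast
      ring

theorem choose_eq_sum_choose_mul_choose {p b : ℕ} (h : 3 * b < 2 * p) :
    (p.choose b : ZMod 2) = ∑ i ∈ Finset.range (b / 2 + 1),
      ((p - b - 1 - i).choose (b - 2 * i) * p.choose i : ZMod 2) := by
  obtain ⟨u, hu⟩ : ∃ u : PowerSeries (ZMod 2), u * (1 + PowerSeries.X) = 1 :=
    ⟨(1 + PowerSeries.X)⁻¹, PowerSeries.inv_mul_cancel _ (by simp)⟩
  have hu' (m k : ℕ) : (1 + PowerSeries.X) ^ (m + k) * u ^ k = (1 + PowerSeries.X) ^ m := by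
    rw [pow_add, mul_assoc, ← mul_pow, mul_comm _ u, hu, one_pow, mul_one]
  rw [← coeff_mul_inv_pow_eq_choose u hu, add_comm (1 + PowerSeries.X), add_pow, Finset.sum_mul,
    map_sum]
  have hle : b / 2 + 1 ≤ p + 1 := by omega
  symm
  apply Finset.sum_subset_zero_on_sdiff (Finset.range_subset_range.2 hle)
  · intro i hi
    simp only [Finset.mem_sdiff, Finset.mem_range, not_lt] at hi
    rw [← pow_mul, mul_assoc, mul_assoc, PowerSeries.coeff_X_pow_mul', if_neg (by omega)]
  · intro i hi
    rw [Finset.mem_range] at hi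
    have h1 : p - i = (p - b - 1 - i) + (b + 1) := by omega
    rw [← pow_mul, mul_assoc, mul_assoc, mul_comm (p.choose i : PowerSeries (ZMod 2)),
      ← mul_assoc (_ ^ (p - i)), h1, hu', PowerSeries.coeff_X_pow_mul', if_pos (by omega)]
    have h2 : (1 + PowerSeries.X : PowerSeries (ZMod 2)) =
        ((1 + Polynomial.X : Polynomial (ZMod 2)) : PowerSeries (ZMod 2)) := by simp
    rw [← map_natCast (PowerSeries.C (R := ZMod 2)), PowerSeries.coeff_mul_C, h2,
      ← Polynomial.coe_pow, Polynomial.coeff_coe, Polynomial.coeff_one_add_X_pow]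

/-- The coefficient of `x ^ a * y ^ b` in `(x ^ 2 + y) ^ p * (x * y) ^ q`. -/
def dicksonCoeff (p q a b : ℕ) : ℕ :=
  if q ≤ b ∧ b ≤ p + q ∧ a + 2 * b = 2 * p + 3 * q then p.choose (b - q) else 0

theorem dicksonCoeff_adem (p q : ℕ) {r s m : ℕ} (hm : m ≤ s) (hrs : 2 * s < r) :
    (dicksonCoeff p q (r - s - m) (s - m) : ZMod 2) =
      ∑ t ∈ (Finset.range (r - s)).filter fun t => r ≤ 2 * t,
        ((t - s - 1).choose (2 * t - r) : ZMod 2) *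
          (if t + m ≤ r + s - t then dicksonCoeff p q (r + s - t - t - m) (t - m) else 0 : ℕ) := by
  by_cases hw : r + s = 2 * p + 3 * q + 3 * m
  swap
  · rw [dicksonCoeff, if_neg (by omega), Nat.cast_zero, Finset.sum_eq_zero]
    intro t ht
    rw [Finset.mem_filter, Finset.mem_range] at ht
    split_ifs with h
    · rw [dicksonCoeff, if_neg (by omega), Nat.cast_zero, mul_zero]
    · rw [Nat.cast_zero, mul_zero]
  by_cases hq : q + m ≤ s
  swap
  · rw [dicksonCoeff, if_neg (by omega), Nat.cast_zero, Finset.sum_eq_zero]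
    intro t ht
    rw [Finset.mem_filter, Finset.mem_range] at ht
    split_ifs with h
    · rw [dicksonCoeff, if_neg (by omega), Nat.cast_zero, mul_zero]
    · rw [Nat.cast_zero, mul_zero]
  rw [dicksonCoeff, if_pos (by omega), choose_eq_sum_choose_mul_choose (by omega)]
  refine Finset.sum_bij_ne_zero (fun i _ _ => p + m + q - i) ?_ ?_ ?_ ?_
  · intro i hi hne
    rw [Finset.mem_range] at hi
    have h0 : ¬ p - (s - m - q) - 1 - i < s - m - q - 2 * i := fun hlt => hne <| by
      rw [Nat.choose_eq_zero_of_lt hlt, Nat.cast_zero, zero_mul]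
    rw [Finset.mem_filter, Finset.mem_range]
    omega
  · intro i hi _ j hj _ hij
    rw [Finset.mem_range] at hi hj
    omega
  · intro t ht hne
    rw [Finset.mem_filter, Finset.mem_range] at ht
    have hle : t + m ≤ r + s - t := by
      by_contra h
      rw [if_neg h, Nat.cast_zero, mul_zero] at hne
      exact hne rfl
    have hc : t - m ≤ p + q := by
      by_contra h
      rw [if_pos hle, dicksonCoeff, if_neg (by omega), Nat.cast_zero, mul_zero] at hne
      exact hne rfl
    rw [if_pos hle, dicksonCoeff, if_pos (by omega)] at hne
    refine ⟨p + m + q - t, Finset.mem_range.2 (by omega), ?_, by omega⟩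
    rw [Nat.choose_symm_of_eq_add (n := p) (a := p + m + q - t) (b := t - m - q) (by omega)]
    convert hne using 4 <;> omega
  · intro i hi _
    rw [Finset.mem_range] at hi
    rw [if_pos (by omega), dicksonCoeff, if_pos (by omega)]
    rw [Nat.choose_symm_of_eq_add (n := p) (a := i) (b := p + m + q - i - m - q) (by omega)]
    congr 3 <;> omega

open Polynomial in
theorem coeff_coeff_eq_dicksonCoeff {R : Type*} [CommRing R] (p q a b : ℕ) :
    ((((X + C (X ^ 2)) ^ p * (X * C X) ^ q : R[X][X])).coeff b).coeff a =
      dicksonCoeff p q a b := by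
  have hpow : (X * C X : R[X][X]) ^ q = X ^ q * C (X ^ q) := by
    rw [C_pow]
    rw [mul_pow]
  have hb : ((X + C (X ^ 2)) ^ p * (X * C X) ^ q : R[X][X]).coeff b =
      if q ≤ b then C (p.choose (b - q) : R) * X ^ (2 * (p - (b - q)) + q)
      else 0 := by
    rw [hpow, ← mul_assoc, coeff_mul_C, coeff_mul_X_pow']
    split_ifs
    · rw [coeff_X_add_C_pow, ← pow_mul, pow_add, C_eq_natCast]
      ring
    · rw [zero_mul]
  rw [hb, dicksonCoeff]
  split_ifs with h₁ h₂ h₂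
  · rw [coeff_C_mul, coeff_X_pow, if_pos (by omega), mul_one]
  · rw [coeff_C_mul, coeff_X_pow, Nat.cast_zero]
    by_cases h₃ : b - q ≤ p
    · rw [if_neg (by omega), mul_zero]
    · rw [Nat.choose_eq_zero_of_lt (by omega), Nat.cast_zero, zero_mul]
  · omega
  · rw [coeff_zero, Nat.cast_zero]

open Polynomial in
theorem adem_of_mem_adjoin {R : Type*} [CommRing R] [Algebra (ZMod 2) R] {r s m : ℕ}
    (hm : m ≤ s) (hrs : 2 * s < r) {g : R[X][X]} (hg : g ∈ Algebra.adjoin R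
    {X + C (X ^ 2),
      (X * C X : R[X][X])}) :
    (g.coeff (s - m)).coeff (r - s - m) =
      ∑ t ∈ (Finset.range (r - s)).filter fun t => r ≤ 2 * t,
        ((t - s - 1).choose (2 * t - r) : ZMod 2) •
          if t + m ≤ r + s - t then (g.coeff (t - m)).coeff (r + s - t - t - m) else 0 := by
  rw [← Subalgebra.mem_toSubmodule, Algebra.adjoin_eq_span] at hg
  induction hg using Submodule.span_induction with
  | mem g hg =>
    obtain ⟨p, q, rfl⟩ := (Submonoid.mem_closure_pair (A := R[X][X]) _ _ _).1 hg
    simp only [coeff_coeff_eq_dicksonCoeff]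
    have := congrArg (algebraMap (ZMod 2) R) (dicksonCoeff_adem p q hm hrs)
    rw [map_natCast, map_sum] at this
    rw [this]
    refine Finset.sum_congr rfl fun t _ => ?_
    rw [map_mul, ← Algebra.smul_def, map_natCast]
    split_ifs <;> simp
  | zero => simp
  | add g h _ _ hg hh =>
    simp only [Polynomial.coeff_add]
    rw [hg, hh, ← Finset.sum_add_distrib]
    refine Finset.sum_congr rfl fun t _ => ?_
    rw [← smul_add]
    split_ifs <;> simp
  | smul P g _ hg =>
    simp only [Polynomial.coeff_smul]
    rw [hg, Finset.smul_sum]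
    refine Finset.sum_congr rfl fun t _ => ?_
    rw [smul_comm]
    split_ifs <;> simp

/-- The polynomial algebra on the Dickson classes; the variable `X i` has index `i + 1`. -/
abbrev DicksonAlgebra := MvPolynomial ℕ (ZMod 2)

/-- The Dickson classes, with the one of index `0` equal to `1`. -/
noncomputable def dicksonClass : ℕ → DicksonAlgebra
  | 0 => 1
  | i + 1 => MvPolynomial.X i

/-- The algebra homomorphism expressing the Dickson classes of rank `k + 1` through those
of rank `k` and one new variable. -/
noncomputable def dicksonStep : DicksonAlgebra →ₐ[ZMod 2] Polynomial DicksonAlgebra :=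
  MvPolynomial.aeval fun i =>
    Polynomial.C (MvPolynomial.X i ^ 2) + Polynomial.X * Polynomial.C (dicksonClass i)

/-- The action of the lower-indexed Dyer–Lashof operation of index `c` on the
algebra of Dickson classes. -/
noncomputable def lowerOp (c : ℕ) : DicksonAlgebra →ₗ[ZMod 2] DicksonAlgebra :=
  (Polynomial.lcoeff DicksonAlgebra c).restrictScalars (ZMod 2) ∘ₗ dicksonStep.toLinearMap

theorem lowerOp_apply (c : ℕ) (P : DicksonAlgebra) :
    lowerOp c P = (dicksonStep P).coeff c := rfl

open Polynomial in
theorem map_dicksonStep_mem_adjoin (P : DicksonAlgebra) :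
    (dicksonStep P).map dicksonStep.toRingHom ∈
      Algebra.adjoin DicksonAlgebra {X + C (X ^ 2), (X * C X : DicksonAlgebra[X][X])} := by
  set S := Algebra.adjoin DicksonAlgebra {X + C (X ^ 2), (X * C X : DicksonAlgebra[X][X])}
  have h₁ : (X + C (X ^ 2) : DicksonAlgebra[X][X]) ∈ S := Algebra.subset_adjoin (by simp)
  have h₂ : (X * C X : DicksonAlgebra[X][X]) ∈ S := Algebra.subset_adjoin (by simp)
  have hC (Q : DicksonAlgebra) : (C (C Q) : DicksonAlgebra[X][X]) ∈ S := S.algebraMap_mem Q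
  have hvar (i : ℕ) : (dicksonStep (MvPolynomial.X i)).map dicksonStep.toRingHom ∈ S := by
    have hX (j : ℕ) : dicksonStep (MvPolynomial.X j) =
        C (MvPolynomial.X j ^ 2) + X * C (dicksonClass j) := MvPolynomial.aeval_X ..
    cases i with
    | zero =>
      have : (dicksonStep (MvPolynomial.X 0)).map dicksonStep.toRingHom =
          C (C (MvPolynomial.X 0 ^ 4)) + (X + C (X ^ 2)) := by
        have h0 : dicksonClass 0 = 1 := rfl
        simp only [hX, h0, Polynomial.map_add, map_C, map_X,
          AlgHom.toRingHom_eq_coe, RingHom.coe_coe, map_pow, Polynomial.map_pow, map_one, mul_one, map_add]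
        rw [CharTwo.add_sq (R := DicksonAlgebra[X][X])]
        ring
      rw [this]
      exact S.add_mem (hC _) h₁
    | succ i =>
      have : (dicksonStep (MvPolynomial.X (i + 1))).map dicksonStep.toRingHom =
          C (C (MvPolynomial.X (i + 1) ^ 4)) + (X + C (X ^ 2)) * C (C (MvPolynomial.X i ^ 2)) +
            X * C X * C (C (dicksonClass i)) := by
        have h0 : dicksonClass (i + 1) = MvPolynomial.X i := rfl
        simp only [hX, h0, Polynomial.map_add, Polynomial.map_mul, map_C, map_X, map_mul,
          AlgHom.toRingHom_eq_coe, RingHom.coe_coe, map_pow, Polynomial.map_pow, map_add]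
        rw [CharTwo.add_sq (R := DicksonAlgebra[X][X])]
        ring
      rw [this]
      exact S.add_mem (S.add_mem (hC _) (S.mul_mem h₁ (hC _))) (S.mul_mem h₂ (hC _))
  induction P using MvPolynomial.induction_on with
  | C a =>
    have : (dicksonStep (MvPolynomial.C a)).map dicksonStep.toRingHom =
        C (C (MvPolynomial.C a)) := by
      have h (a : ZMod 2) : dicksonStep (MvPolynomial.C a) = C (MvPolynomial.C a) :=
        dicksonStep.commutes a
      rw [h, map_C]
      exact congrArg C (h a)
    exact this ▸ hC _
  | add P Q hP hQ =>
    rw [map_add, Polynomial.map_add]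
    exact S.add_mem hP hQ
  | mul_X P i hP =>
    rw [map_mul, Polynomial.map_mul]
    exact S.mul_mem hP (hvar i)

theorem lowerOp_lowerOp (P : DicksonAlgebra) {r s m : ℕ} (hm : m ≤ s) (hrs : 2 * s < r) :
    lowerOp (r - s - m) (lowerOp (s - m) P) =
      ∑ t ∈ (Finset.range (r - s)).filter fun t => r ≤ 2 * t,
        ((t - s - 1).choose (2 * t - r) : ZMod 2) •
          if t + m ≤ r + s - t then lowerOp (r + s - t - t - m) (lowerOp (t - m) P) else 0 := by
  have h := adem_of_mem_adjoin hm hrs (map_dicksonStep_mem_adjoin P)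
  simp only [Polynomial.coeff_map] at h
  exact h

/-- A free module whose summands are indexed by a degree and a word length. -/
abbrev LowerModule := ℕ × ℕ →₀ DicksonAlgebra

/-- The action of `q_j`: on degree `d` it is the lower-indexed operation of index `j - d - n`. -/
noncomputable def upperOp (n j : ℕ) : Module.End (ZMod 2) LowerModule :=
  Finsupp.lsum (ZMod 2) fun d =>
    if d.1 + n ≤ j then Finsupp.lsingle (d.1 + j, d.2 + 1) ∘ₗ lowerOp (j - (d.1 + n)) else 0

theorem upperOp_single (n j : ℕ) (d : ℕ × ℕ) (P : DicksonAlgebra) :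
    upperOp n j (Finsupp.single d P) =
      if d.1 + n ≤ j then Finsupp.single (d.1 + j, d.2 + 1) (lowerOp (j - (d.1 + n)) P)
      else 0 := by
  rw [upperOp, Finsupp.lsum_single]
  split_ifs <;> rfl

/-- The representation of the free algebra on the generators `q_j`. -/
noncomputable def freeRep (n : ℕ) :
    FreeAlgebra (ZMod 2) (DLGen n) →ₐ[ZMod 2] Module.End (ZMod 2) LowerModule :=
  FreeAlgebra.lift (ZMod 2) fun j => upperOp n j.1

theorem freeRep_ι (n : ℕ) (j : DLGen n) :
    freeRep n (FreeAlgebra.ι (ZMod 2) j) = upperOp n j.1 :=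
  FreeAlgebra.lift_ι_apply ..

theorem dlWord_cons (n : ℕ) (j : DLGen n) (J : List (DLGen n)) :
    dlWord n (j :: J) = FreeAlgebra.ι (ZMod 2) j * dlWord n J := by
  rw [dlWord, List.map_cons, List.prod_cons, dlWord]

theorem dlWord_append (n : ℕ) (I J : List (DLGen n)) :
    dlWord n (I ++ J) = dlWord n I * dlWord n J := by
  rw [dlWord, List.map_append, List.prod_append, dlWord, dlWord]

theorem freeRep_dlWord_cons (n : ℕ) (j : DLGen n) (J : List (DLGen n)) (x : LowerModule) :
    freeRep n (dlWord n (j :: J)) x = upperOp n j.1 (freeRep n (dlWord n J) x) := by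
  rw [dlWord_cons, map_mul, freeRep_ι, Module.End.mul_apply]

theorem exists_freeRep_dlWord_single (n : ℕ) (J : List (DLGen n)) (d : ℕ × ℕ)
    (P : DicksonAlgebra) :
    ∃ Q, freeRep n (dlWord n J) (Finsupp.single d P) =
      Finsupp.single (d.1 + (J.map Subtype.val).sum, d.2 + J.length) Q := by
  induction J with
  | nil => exact ⟨P, by simp [dlWord]⟩
  | cons j J ih =>
    obtain ⟨Q, hQ⟩ := ih
    rw [freeRep_dlWord_cons, hQ, upperOp_single]
    split_ifs
    · refine ⟨lowerOp (j.1 - (d.1 + (J.map Subtype.val).sum + n)) Q, ?_⟩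
      congr 1
      simp only [List.map_cons, List.sum_cons, List.length_cons, Prod.mk.injEq]
      omega
    · exact ⟨0, by rw [Finsupp.single_zero]⟩

theorem upperOp_adem (n : ℕ) {r s : ℕ} (hrs : 2 * s < r) :
    upperOp n r * upperOp n s = ∑ t ∈ (Finset.range (r - s)).filter fun t => r ≤ 2 * t,
      ((t - s - 1).choose (2 * t - r) : ZMod 2) • (upperOp n (r + s - t) * upperOp n t) := by
  refine Finsupp.lhom_ext fun d P => ?_
  rw [LinearMap.sum_apply]
  simp only [LinearMap.smul_apply, Module.End.mul_apply]
  by_cases hs : d.1 + n ≤ s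
  · rw [upperOp_single, if_pos hs, upperOp_single, if_pos (by dsimp only; omega),
      show r - (d.1 + s + n) = r - s - (d.1 + n) by omega, lowerOp_lowerOp P hs hrs,
      ← Finsupp.lsingle_apply (R := ZMod 2), map_sum]
    refine Finset.sum_congr rfl fun t ht => ?_
    rw [Finset.mem_filter, Finset.mem_range] at ht
    rw [map_smul, upperOp_single, if_pos (show d.1 + n ≤ t by omega), upperOp_single]
    dsimp only
    congr 1
    by_cases h : t + (d.1 + n) ≤ r + s - t
    · rw [if_pos h, if_pos (by omega), Finsupp.lsingle_apply]
      congr 2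
      · omega
      · congr 1
        omega
    · rw [if_neg h, if_neg (by omega), map_zero]
  · rw [upperOp_single, if_neg hs, map_zero, Finset.sum_eq_zero]
    intro t ht
    rw [Finset.mem_filter, Finset.mem_range] at ht
    rw [upperOp_single]
    split_ifs
    · rw [upperOp_single, if_neg (by dsimp only; omega), smul_zero]
    · rw [map_zero, smul_zero]

theorem freeRep_rel (n : ℕ) {x y : FreeAlgebra (ZMod 2) (DLGen n)} (h : DLRel n x y) :
    freeRep n x = freeRep n y := by
  cases h with
  | excess j J h =>
    rw [map_zero]
    refine Finsupp.lhom_ext fun d P => ?_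
    obtain ⟨Q, hQ⟩ := exists_freeRep_dlWord_single n J d P
    rw [freeRep_dlWord_cons, hQ, upperOp_single, if_neg (by dsimp only; omega),
      LinearMap.zero_apply]
  | adem r s hs hrs =>
    rw [map_mul, freeRep_ι, freeRep_ι, upperOp_adem n hrs, dlAdemSum, map_sum,
      ← Finset.sum_attach]
    refine Finset.sum_congr rfl fun t _ => ?_
    rw [map_smul, map_mul, freeRep_ι, freeRep_ι]

/-- The representation of `DL n` on `LowerModule`. -/
noncomputable def dlRep (n : ℕ) : DL n →ₐ[ZMod 2] Module.End (ZMod 2) LowerModule :=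
  RingQuot.liftAlgHom (ZMod 2) ⟨freeRep n, fun _ _ => freeRep_rel n⟩

theorem dlRep_dlMk (n : ℕ) (x : FreeAlgebra (ZMod 2) (DLGen n)) :
    dlRep n (dlMk n x) = freeRep n x :=
  RingQuot.liftAlgHom_mkAlgHom_apply ..

/-- Admissible sequences of excess at least `n`. -/
abbrev IsAdmissible (n : ℕ) (I : List (DLGen n)) : Prop :=
  I.IsChain (fun a b : DLGen n => a.1 ≤ 2 * b.1) ∧
    ∀ i ∈ I.head?, (I.tail.map Subtype.val).sum + n ≤ i.1

theorem IsAdmissible.tail {n : ℕ} {j : DLGen n} {J : List (DLGen n)}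
    (h : IsAdmissible n (j :: J)) : IsAdmissible n J := by
  refine ⟨h.1.tail, fun i hi => ?_⟩
  cases J with
  | nil => simp at hi
  | cons k K =>
    obtain rfl : k = i := by simpa using hi
    have h₁ := (List.isChain_cons_cons.1 h.1).1
    have h₂ := h.2 j rfl
    simp only [List.tail_cons, List.map_cons, List.sum_cons] at h₂ ⊢
    omega

/-- The lower indices of a word acting on a class of degree `n`. -/
def lowerIndices (n : ℕ) : List (DLGen n) → List ℕ
  | [] => []
  | j :: J => (j.1 - ((J.map Subtype.val).sum + n)) :: lowerIndices n J

theorem length_lowerIndices (n : ℕ) (J : List (DLGen n)) :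
    (lowerIndices n J).length = J.length := by
  induction J with
  | nil => rfl
  | cons j J ih => rw [lowerIndices, List.length_cons, List.length_cons, ih]

theorem lowerIndices_injOn (n : ℕ) : Set.InjOn (lowerIndices n) {J | IsAdmissible n J} := by
  intro I hI J hJ h
  induction I generalizing J with
  | nil =>
    cases J with
    | nil => rfl
    | cons j J => simp [lowerIndices] at h
  | cons i I ih =>
    cases J with
    | nil => simp [lowerIndices] at h
    | cons j J =>
      simp only [lowerIndices, List.cons.injEq] at h
      obtain rfl := ih (IsAdmissible.tail hI) (IsAdmissible.tail hJ) h.2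
      have h₁ := hI.2 i rfl
      have h₂ := hJ.2 j rfl
      rw [List.tail_cons] at h₁ h₂
      rw [Subtype.ext (by omega : i.1 = j.1)]

theorem IsAdmissible.isChain_lowerIndices {n : ℕ} {J : List (DLGen n)}
    (h : IsAdmissible n J) : (lowerIndices n J).IsChain (· ≤ ·) := by
  induction J with
  | nil => exact .nil
  | cons j J ih =>
    cases J with
    | nil => exact .singleton _
    | cons k K =>
      refine List.isChain_cons_cons.2 ⟨?_, ih h.tail⟩
      have h₁ := (List.isChain_cons_cons.1 h.1).1
      simp only [List.map_cons, List.sum_cons]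
      omega

theorem IsAdmissible.freeRep_dlWord {n : ℕ} {J : List (DLGen n)} (h : IsAdmissible n J)
    (P : DicksonAlgebra) :
    freeRep n (dlWord n J) (Finsupp.single (0, 0) P) =
      Finsupp.single ((J.map Subtype.val).sum, J.length)
        ((lowerIndices n J).foldr (fun c Q => lowerOp c Q) P) := by
  induction J with
  | nil => simp [dlWord, lowerIndices]
  | cons j J ih =>
    have h₁ := h.2 j rfl
    rw [List.tail_cons] at h₁
    rw [freeRep_dlWord_cons, ih h.tail, upperOp_single, if_pos h₁, List.map_cons, List.sum_cons,
      List.length_cons, lowerIndices, List.foldr_cons, add_comm j.1]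

/-- The monomial in the Dickson classes dual to a nonincreasing sequence of lower indices,
with variables shifted by `o`. -/
noncomputable def dicksonMonomial : ℕ → List ℕ → DicksonAlgebra
  | _, [] => 1
  | o, k :: K => MvPolynomial.X o ^ (k - K.headD 0) * dicksonMonomial (o + 1) K

theorem natDegree_dicksonStep_X_pow (i m : ℕ) :
    (dicksonStep (MvPolynomial.X i ^ m)).natDegree ≤ m ∧
      (dicksonStep (MvPolynomial.X i ^ m)).coeff m = dicksonClass i ^ m := by
  have hX : dicksonStep (MvPolynomial.X i) =
      Polynomial.C (MvPolynomial.X i ^ 2) + Polynomial.X * Polynomial.C (dicksonClass i) :=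
    MvPolynomial.aeval_X ..
  have hd : (dicksonStep (MvPolynomial.X i)).natDegree ≤ 1 := by
    rw [hX]
    compute_degree
  have hc : (dicksonStep (MvPolynomial.X i)).coeff 1 = dicksonClass i := by
    rw [hX, Polynomial.coeff_add, Polynomial.coeff_mul_C, Polynomial.coeff_X_one, one_mul,
      Polynomial.coeff_C_of_ne_zero one_ne_zero, zero_add]
  rw [map_pow]
  refine ⟨by simpa using Polynomial.natDegree_pow_le_of_le m hd, ?_⟩
  have := Polynomial.coeff_pow_of_natDegree_le (m := m) hd
  rwa [mul_one, hc] at this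

theorem dicksonStep_mul_top {P Q : DicksonAlgebra} {d e : ℕ}
    (hP : (dicksonStep P).natDegree ≤ d) (hQ : (dicksonStep Q).natDegree ≤ e) :
    (dicksonStep (P * Q)).natDegree ≤ d + e ∧
      (dicksonStep (P * Q)).coeff (d + e) = (dicksonStep P).coeff d * (dicksonStep Q).coeff e := by
  rw [map_mul]
  exact ⟨Polynomial.natDegree_mul_le_of_le hP hQ, Polynomial.coeff_mul_add_eq_of_natDegree_le hP hQ⟩

theorem headD_le_of_isChain {k : ℕ} {K : List ℕ} (h : (k :: K).IsChain (· ≥ ·)) :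
    K.headD 0 ≤ k := by
  cases K with
  | nil => exact k.zero_le
  | cons l L => exact (List.isChain_cons_cons.1 h).1

theorem dicksonStep_dicksonMonomial_succ {K : List ℕ} (hK : K.IsChain (· ≥ ·)) (o : ℕ) :
    (dicksonStep (dicksonMonomial (o + 1) K)).natDegree ≤ K.headD 0 ∧
      (dicksonStep (dicksonMonomial (o + 1) K)).coeff (K.headD 0) = dicksonMonomial o K := by
  induction K generalizing o with
  | nil => simp [dicksonMonomial]
  | cons k K ih =>
    have h₁ := natDegree_dicksonStep_X_pow (o + 1) (k - K.headD 0)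
    have h₂ := ih hK.tail (o + 1)
    have h₃ := dicksonStep_mul_top h₁.1 h₂.1
    rw [h₁.2, h₂.2, Nat.sub_add_cancel (headD_le_of_isChain hK)] at h₃
    exact h₃

theorem dicksonStep_dicksonMonomial_zero {k : ℕ} {K : List ℕ} (hK : (k :: K).IsChain (· ≥ ·)) :
    (dicksonStep (dicksonMonomial 0 (k :: K))).natDegree ≤ k ∧
      (dicksonStep (dicksonMonomial 0 (k :: K))).coeff k = dicksonMonomial 0 K := by
  have h₁ := natDegree_dicksonStep_X_pow 0 (k - K.headD 0)
  have h₂ := dicksonStep_dicksonMonomial_succ (K := K) hK.tail 0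
  have h₃ := dicksonStep_mul_top h₁.1 h₂.1
  rw [h₁.2, h₂.2, Nat.sub_add_cancel (headD_le_of_isChain hK), dicksonClass, one_pow,
    one_mul] at h₃
  exact h₃

theorem foldl_lowerOp_dicksonMonomial_self {K : List ℕ} (hK : K.IsChain (· ≥ ·)) :
    K.foldl (fun P c => lowerOp c P) (dicksonMonomial 0 K) = 1 := by
  induction K with
  | nil => rfl
  | cons k K ih =>
    rw [List.foldl_cons, lowerOp_apply, (dicksonStep_dicksonMonomial_zero hK).2, ih hK.tail]

theorem le_of_foldl_lowerOp_ne_zero {K R : List ℕ} (hK : K.IsChain (· ≥ ·))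
    (hl : R.length = K.length)
    (h : R.foldl (fun P c => lowerOp c P) (dicksonMonomial 0 K) ≠ 0) : R ≤ K := by
  induction K generalizing R with
  | nil => rw [List.length_eq_zero_iff.1 hl]
  | cons k K ih =>
    cases R with
    | nil => simp at hl
    | cons c R =>
      have hstep := dicksonStep_dicksonMonomial_zero hK
      rw [List.foldl_cons, lowerOp_apply] at h
      rcases lt_trichotomy c k with hc | rfl | hc
      · exact le_of_lt (.rel hc)
      · rw [hstep.2] at h
        exact List.cons_le_cons c (ih hK.tail (by simpa using hl) h)
      · rw [Polynomial.coeff_eq_zero_of_natDegree_lt (hstep.1.trans_lt hc)] at h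
        have hzero : ∀ L : List ℕ, L.foldl (fun P c => lowerOp c P) 0 = 0 := by
          intro L
          induction L with
          | nil => rfl
          | cons a L ih => rw [List.foldl_cons, map_zero, ih]
        exact absurd (hzero R) h

theorem linearIndependent_admissible (n : ℕ) :
    LinearIndependent (ZMod 2) (fun I : AdmSeq n => dlMk n (dlWord n I.1)) := by
  classical
  let key (I : AdmSeq n) : List ℕ := (lowerIndices n I.1).reverse
  rw [linearIndependent_iff']
  intro s g hg
  by_contra! hne
  obtain ⟨I₀, hI₀, hgI₀⟩ := hne
  obtain ⟨J, hJ, hmin⟩ := Finset.exists_min_image (s.filter fun I => g I ≠ 0) key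
    ⟨I₀, Finset.mem_filter.2 ⟨hI₀, hgI₀⟩⟩
  rw [Finset.mem_filter] at hJ
  have hchain : (key J).IsChain (· ≥ ·) :=
    List.isChain_reverse.2 (IsAdmissible.isChain_lowerIndices J.2)
  let φ : DL n →ₗ[ZMod 2] DicksonAlgebra :=
    Finsupp.lapply ((J.1.map Subtype.val).sum, J.1.length) ∘ₗ
      LinearMap.applyₗ (Finsupp.single (0, 0) (dicksonMonomial 0 (key J))) ∘ₗ
        (dlRep n).toLinearMap
  have hφ (I : AdmSeq n) : φ (dlMk n (dlWord n I.1)) =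
      Finsupp.single ((I.1.map Subtype.val).sum, I.1.length)
        ((key I).foldl (fun P c => lowerOp c P) (dicksonMonomial 0 (key J)))
        ((J.1.map Subtype.val).sum, J.1.length) := by
    rw [List.foldl_reverse, ← IsAdmissible.freeRep_dlWord I.2, ← dlRep_dlMk]
    rfl
  have hsum := congrArg φ hg
  rw [map_sum, map_zero, Finset.sum_eq_single J] at hsum
  · rw [map_smul, hφ, Finsupp.single_eq_same, foldl_lowerOp_dicksonMonomial_self hchain] at hsum
    exact hJ.2 ((smul_eq_zero.1 hsum).resolve_right one_ne_zero)
  · intro I hI hIJ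
    by_cases hgI : g I = 0
    · rw [hgI, zero_smul, map_zero]
    rw [map_smul, hφ, Finsupp.single_apply]
    split_ifs with hd
    · rw [smul_eq_zero]
      refine .inr ?_
      by_contra hfold
      have hle := le_of_foldl_lowerOp_ne_zero hchain
        (by simp only [key, List.length_reverse, length_lowerIndices]; exact congrArg Prod.snd hd)
        hfold
      have heq := le_antisymm hle (hmin I (Finset.mem_filter.2 ⟨hI, hgI⟩))
      exact hIJ (Subtype.ext (lowerIndices_injOn n I.2 J.2 (List.reverse_injective heq)))
    · rw [smul_zero]
  · exact fun h => absurd hJ.1 h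

/-- The sum of all partial sums of a word. -/
def wordWeight (n : ℕ) : List (DLGen n) → ℕ
  | [] => 0
  | j :: J => j.1 * (J.length + 1) + wordWeight n J

theorem wordWeight_append_lt (n : ℕ) (u : List (DLGen n)) {v w : List (DLGen n)}
    (hl : v.length = w.length) (h : wordWeight n v < wordWeight n w) :
    wordWeight n (u ++ v) < wordWeight n (u ++ w) := by
  induction u with
  | nil => exact h
  | cons j u ih =>
    simp only [List.cons_append, wordWeight, List.length_append, hl]
    omega

theorem dlMk_dlWord_mem_span (n : ℕ) (J : List (DLGen n)) :
    dlMk n (dlWord n J) ∈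
      Submodule.span (ZMod 2) (Set.range fun I : AdmSeq n => dlMk n (dlWord n I.1)) := by
  induction hw : wordWeight n J using Nat.strong_induction_on generalizing J with
  | _ w ih =>
    subst hw
    by_cases hJ : J.IsChain (fun a b : DLGen n => a.1 ≤ 2 * b.1)
    · by_cases hh : ∀ i ∈ J.head?, (J.tail.map Subtype.val).sum + n ≤ i.1
      · exact Submodule.subset_span ⟨⟨J, hJ, hh⟩, rfl⟩
      · cases J with
        | nil => simp at hh
        | cons j J =>
          have : j.1 < (J.map Subtype.val).sum + n := by simpa using hh
          have hz : dlMk n (dlWord n (j :: J)) = dlMk n 0 :=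
            RingQuot.mkAlgHom_rel (ZMod 2) (DLRel.excess j J this)
          rw [hz, map_zero]
          exact Submodule.zero_mem _
    · rw [List.isChain_iff_forall_rel_of_append_cons_cons] at hJ
      push Not at hJ
      obtain ⟨⟨r, hr⟩, ⟨s, hs⟩, u, v, rfl, hrs⟩ := hJ
      dsimp only at hrs
      have hrel : dlMk n (FreeAlgebra.ι (ZMod 2) ⟨r, hr⟩ * FreeAlgebra.ι (ZMod 2) ⟨s, hs⟩) =
          dlMk n (dlAdemSum n r s hs hrs) :=
        RingQuot.mkAlgHom_rel (ZMod 2) (DLRel.adem r s hs hrs)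
      rw [dlWord_append, dlWord_cons, dlWord_cons, ← mul_assoc (FreeAlgebra.ι _ _), map_mul,
        map_mul, hrel, ← map_mul, ← map_mul, dlAdemSum, Finset.sum_mul, Finset.mul_sum, map_sum]
      refine Submodule.sum_mem _ fun t _ => ?_
      have ht := t.2
      rw [Finset.mem_filter, Finset.mem_range] at ht
      rw [smul_mul_assoc, mul_smul_comm, map_smul, mul_assoc, ← dlWord_cons, ← dlWord_cons,
        ← dlWord_append]
      refine Submodule.smul_mem _ _ (ih _ ?_ _ rfl)
      refine wordWeight_append_lt n u rfl ?_
      simp only [wordWeight, List.length_cons]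
      have hsum : (r + s - t.1) + t.1 = r + s := by omega
      have hlt : r + s - t.1 < r := by omega
      nlinarith

theorem span_range_dlWord (n : ℕ) :
    Submodule.span (ZMod 2) (Set.range (dlWord n)) = ⊤ := by
  refine Submodule.eq_top_iff'.2 fun x => ?_
  induction x using FreeAlgebra.induction with
  | grade0 a =>
    rw [Algebra.algebraMap_eq_smul_one]
    exact Submodule.smul_mem _ _ (Submodule.subset_span ⟨[], rfl⟩)
  | grade1 j => exact Submodule.subset_span ⟨[j], by simp [dlWord]⟩
  | add x y hx hy => exact Submodule.add_mem _ hx hy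
  | mul x y hx hy =>
    have hxy := Submodule.mul_mem_mul hx hy
    rw [Submodule.span_mul_span] at hxy
    refine Submodule.span_mono ?_ hxy
    rintro _ ⟨_, ⟨I, rfl⟩, _, ⟨J, rfl⟩, rfl⟩
    exact ⟨I ++ J, dlWord_append n I J⟩

theorem span_admissible_eq_top (n : ℕ) :
    Submodule.span (ZMod 2) (Set.range fun I : AdmSeq n => dlMk n (dlWord n I.1)) = ⊤ := by
  refine top_le_iff.1 ?_
  have hsurj : Function.Surjective (dlMk n).toLinearMap := 
    RingQuot.mkAlgHom_surjective (ZMod 2) (DLRel n)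
  rw [← LinearMap.range_eq_top.2 hsurj, LinearMap.range_eq_map, ← span_range_dlWord,
    Submodule.map_span, Submodule.span_le]
  rintro _ ⟨_, ⟨J, rfl⟩, rfl⟩
  exact dlMk_dlWord_mem_span n J

end DyerLashof

/-- For `n ≥ 0`, the images in the mod 2 Dyer–Lashof algebra `R_n` of the words
`q_{j_1}⋯q_{j_k}`, as `(j_1, …, j_k)` ranges over all admissible sequences of natural
numbers `≥ n` of excess at least `n` (the empty sequence contributing the unit `1`),
form a basis of `R_n` over `ZMod 2`: they are linearly independent and span. -/
theorem dl_admissible_basis (n : ℕ) :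
    LinearIndependent (ZMod 2) (fun I : AdmSeq n => dlMk n (dlWord n I.1)) ∧
      Submodule.span (ZMod 2) (Set.range fun I : AdmSeq n => dlMk n (dlWord n I.1)) = ⊤ :=
  ⟨DyerLashof.linearIndependent_admissible n, DyerLashof.span_admissible_eq_top n⟩
end
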